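/- arXiv:2104.00579 — 2 statements merged into one kernel-verified Lean document; each statement's English description precedes it below -/
import Mathlib

section
/- Let X be a metric space, Y a Hausdorff topological space, K ⊆ X a compact set, U ⊆ X an open set containing K, and f : X → Y a map continuous on U. Suppose f is injective on K and f is locally injective at every point of K (i.e. every x ∈ K has a neighborhood on which f is injective). Then there exists an open set W with K ⊆ W ⊆ U such that f is injective on W. -/
/-- A map continuous on an open neighborhood `U` of a compact set
`K`, injective on `K` and locally injective at every point of `K`, is injective
on some open set `W` with `K ⊆ W ⊆ U`. -/
theorem exists_isOpen_injOn_of_injOn_compact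
    {X Y : Type*} [MetricSpace X] [TopologicalSpace Y] [T2Space Y]
    (K U : Set X) (hK : IsCompact K) (hU : IsOpen U) (hKU : K ⊆ U)
    (f : X → Y) (hf : ContinuousOn f U) (hinj : Set.InjOn f K)
    (hloc : ∀ x ∈ K, ∃ V ∈ nhds x, Set.InjOn f V) :
    ∃ W : Set X, IsOpen W ∧ K ⊆ W ∧ W ⊆ U ∧ Set.InjOn f W := by
  obtain ⟨T, hT, hKT, hfT⟩ := hinj.exists_isOpen_superset hK
    (fun x hx => hf.continuousAt (hU.mem_nhds (hKU hx))) hloc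
  exact ⟨T ∩ U, hT.inter hU, Set.subset_inter hKT hKU, Set.inter_subset_right,
    hfT.mono Set.inter_subset_left⟩
end

section
/- Let D ⊆ ℂ be a nonempty bounded open simply connected domain with 0 ∈ D. Then D is holomorphically contractible to 0: there exists a map F : ℂ × ℝ → ℂ such that F is continuous on D × [0,1]; for every t ∈ [0,1] the map z ↦ F(z,t) is holomorphic on D and maps D into D; F(z,0) = z and F(z,1) = 0 for all z ∈ D; and F(0,t) = 0 for all t ∈ [0,1]. -/
open Set Metric Filter Topology Complex ComplexConjugate

/-- Montel's theorem, along an ultrafilter. -/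
theorem exists_tendstoLocallyUniformlyOn_of_mapsTo_closedBall {ι : Type*} {D : Set ℂ}
    (hD : IsOpen D) (l : Ultrafilter ι) {F : ι → ℂ → ℂ} (hF : ∀ i, DifferentiableOn ℂ (F i) D)
    (hmaps : ∀ i, MapsTo (F i) D (closedBall 0 1)) :
    ∃ g : ℂ → ℂ, TendstoLocallyUniformlyOn F g l D := by
  have hlim : ∀ z, ∃ w, z ∈ D → Tendsto (fun i => F i z) l (𝓝 w) := by
    intro z
    by_cases hz : z ∈ D
    · obtain ⟨w, -, hw⟩ := (isCompact_closedBall (0 : ℂ) 1).ultrafilter_le_nhds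
        (l.map fun i => F i z) (by
          rw [le_principal_iff]
          exact mem_map.2 (univ_mem' fun i => hmaps i hz))
      exact ⟨w, fun _ => hw⟩
    · exact ⟨0, fun h => absurd h hz⟩
  choose g hg using hlim
  have hequi : ∀ K ∈ {K : Set ℂ | K ⊆ D ∧ IsCompact K}, EquicontinuousOn F K := by
    rintro K ⟨hKD, -⟩ z hz
    obtain ⟨r, hr, hball⟩ := isOpen_iff.1 hD z (hKD hz)
    refine (equicontinuousAt_of_continuity_modulus (fun x => 2 / r * dist x z) ?_ F
      ?_).equicontinuousWithinAt K
    · have : Continuous fun x : ℂ => 2 / r * dist x z := by fun_prop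
      simpa using this.tendsto z
    · filter_upwards [ball_mem_nhds z hr] with x hx i
      rw [dist_comm]
      refine dist_le_div_mul_dist_of_mapsTo_ball ((hF i).mono hball) (fun y hy => ?_) hx
      have h1 := hmaps i (hball hy)
      have h2 := hmaps i (hKD hz)
      rw [mem_closedBall] at *
      linarith [dist_triangle_right (F i y) (F i z) 0]
  refine ⟨g, (tendstoLocallyUniformlyOn_iff_forall_isCompact hD).2 fun K hKD hK => ?_⟩
  have := (EquicontinuousOn.tendsto_uniformOnFun_iff_pi' (fun K hK => hK.2) hequi l g).2 (by
    rw [tendsto_pi_nhds]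
    rintro ⟨z, K, ⟨hKD, -⟩, hz⟩
    exact hg z (hKD hz))
  exact UniformOnFun.tendsto_iff_tendstoUniformlyOn.1 this K ⟨hKD, hK⟩

/-- A locally uniform limit of injective holomorphic functions whose derivative does not vanish
identically is injective. -/
theorem injOn_of_tendstoLocallyUniformlyOn {ι : Type*} {D : Set ℂ} (hD : IsOpen D)
    (hconn : IsPreconnected D) {l : Filter ι} [l.NeBot] {F : ι → ℂ → ℂ} {g : ℂ → ℂ}
    (hF : ∀ i, DifferentiableOn ℂ (F i) D) (hinj : ∀ i, InjOn (F i) D)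
    (hlim : TendstoLocallyUniformlyOn F g l D) {c : ℂ} (hc : c ∈ D) (hderiv : deriv g c ≠ 0) :
    InjOn g D := by
  intro a ha b hb hab
  by_contra hne
  have hg : AnalyticOnNhd ℂ g D :=
    (hlim.differentiableOn (.of_forall hF) hD).analyticOnNhd hD
  have isolated : ∀ x ∈ D, ∀ᶠ z in 𝓝[≠] x, g z ≠ g x := by
    intro x hx
    rcases (hg x hx).eventually_eq_or_eventually_ne analyticAt_const (g := fun _ => g x)
      with h | h
    · have heq := hg.eqOn_of_preconnected_of_eventuallyEq analyticOnNhd_const hconn hx h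
      exact absurd ((heq.eventuallyEq_of_mem (hD.mem_nhds hc)).deriv_eq.trans (by simp)) hderiv
    · exact h
  -- On a small circle around each point, `g` stays away from its value at the centre.
  have circle : ∀ x ∈ D, ∃ R > 0, ∀ r, 0 < r → r < R → closedBall x r ⊆ D ∧ ∃ ε > 0,
      ∀ z ∈ sphere x r, ε ≤ ‖g z - g x‖ := by
    intro x hx
    obtain ⟨R, hR, hRsub⟩ := mem_nhdsWithin_iff.1 (isolated x hx)
    obtain ⟨R', hR', hRsub'⟩ := isOpen_iff.1 hD x hx
    refine ⟨min R R', lt_min hR hR', fun r hr0 hr => ?_⟩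
    have hsub : closedBall x r ⊆ D :=
      (closedBall_subset_ball (hr.trans_le (min_le_right _ _))).trans hRsub'
    refine ⟨hsub, ?_⟩
    obtain ⟨z, hz, hmin⟩ := (isCompact_sphere x r).exists_isMinOn
      (NormedSpace.sphere_nonempty.2 hr0.le)
      ((hg.continuousOn.mono (sphere_subset_closedBall.trans hsub)).sub continuousOn_const
        (g := fun _ => g x)).norm
    refine ⟨‖g z - g x‖, norm_pos_iff.2 (sub_ne_zero.2 (hRsub ⟨?_, ?_⟩)), hmin⟩
    · exact sphere_subset_closedBall.trans
        (closedBall_subset_ball (hr.trans_le (min_le_left _ _))) hz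
    · exact ne_of_mem_sphere hz hr0.ne'
  -- Near the centre of such a circle, `F i` eventually takes all values close to `g x`.
  have covers : ∀ x ∈ D, ∃ R > 0, ∀ r, 0 < r → r < R → ∃ ε > 0, ∀ δ, 0 < δ → δ ≤ ε →
      ∀ᶠ i in l, ball (F i x) (3 * δ) ⊆ F i '' (closedBall x r ∩ D) ∧ ‖F i x - g x‖ < δ := by
    intro x hx
    obtain ⟨R, hR, h⟩ := circle x hx
    refine ⟨R, hR, fun r hr0 hr => ?_⟩
    obtain ⟨hsub, ε, hε, hsphere⟩ := h r hr0 hr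
    refine ⟨ε / 8, by positivity, fun δ hδ0 hδ => ?_⟩
    have hunif := (tendstoLocallyUniformlyOn_iff_forall_isCompact hD).1 hlim _ hsub
      (isCompact_closedBall x r)
    filter_upwards [Metric.tendstoUniformlyOn_iff.1 hunif δ hδ0] with i hi
    have hix := hi x (mem_closedBall_self hr0.le)
    rw [dist_eq_norm] at hix
    have hlow : ∀ z ∈ sphere x r, 6 * δ ≤ ‖F i z - F i x‖ := by
      intro z hz
      have h1 := hi z (sphere_subset_closedBall hz)
      rw [dist_eq_norm] at h1
      have h2 := hsphere z hz
      have h3 : g z - g x = (g z - F i z) + (F i z - F i x) - (g x - F i x) := by ring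
      have h4 := norm_sub_le ((g z - F i z) + (F i z - F i x)) (g x - F i x)
      have h5 := norm_add_le (g z - F i z) (F i z - F i x)
      rw [← h3] at h4
      linarith
    refine ⟨?_, by rwa [norm_sub_rev]⟩
    have hdiff : DiffContOnCl ℂ (F i) (ball x r) :=
      ((hF i).mono (closure_ball_subset_closedBall.trans hsub)).diffContOnCl
    have hfreq : ∃ᶠ z in 𝓝 x, F i z ≠ F i x := by
      refine Filter.Frequently.filter_mono (f := 𝓝[≠] x) (Eventually.frequently ?_)
        nhdsWithin_le_nhds
      filter_upwards [self_mem_nhdsWithin, mem_nhdsWithin_of_mem_nhds (hD.mem_nhds hx)]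
        with z hz hzD heq
      exact hz (hinj i hzD hx heq)
    have := hdiff.ball_subset_image_closedBall hr0 hlow hfreq
    rw [inter_eq_left.2 hsub]
    convert this using 2
    ring
  obtain ⟨R₁, hR₁, h₁⟩ := covers a ha
  obtain ⟨R₂, hR₂, h₂⟩ := covers b hb
  have hd : 0 < dist a b := dist_pos.2 hne
  obtain ⟨r, hr0, hr⟩ : ∃ r, 0 < r ∧ r < min (min R₁ R₂) (dist a b / 2) :=
    exists_between (by positivity)
  simp only [lt_min_iff] at hr
  obtain ⟨ε₁, hε₁, h₁⟩ := h₁ r hr0 hr.1.1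
  obtain ⟨ε₂, hε₂, h₂⟩ := h₂ r hr0 hr.1.2
  have hδ : 0 < min ε₁ ε₂ := lt_min hε₁ hε₂
  obtain ⟨i, ⟨hi₁, hia⟩, hi₂, hib⟩ :=
    ((h₁ _ hδ (min_le_left _ _)).and (h₂ _ hδ (min_le_right _ _))).exists
  obtain ⟨x, ⟨hxr, hxD⟩, hx⟩ := hi₁ (mem_ball_self (by positivity))
  have hclose : F i a ∈ ball (F i b) (3 * min ε₁ ε₂) := by
    rw [mem_ball, dist_eq_norm,
      show F i a - F i b = (F i a - g a) - (F i b - g b) by rw [hab]; ring]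
    linarith [norm_sub_le (F i a - g a) (F i b - g b)]
  obtain ⟨y, ⟨hyr, hyD⟩, hy⟩ := hi₂ hclose
  have hxy : x = y := hinj i hxD hyD (hx.trans hy.symm)
  rw [mem_closedBall] at hxr hyr
  subst hxy
  linarith [dist_triangle_left a b x]

/-- The disc automorphism sending `w` to `0`. -/
noncomputable def discShift (w z : ℂ) : ℂ := (z - w) / (1 - conj w * z)

theorem one_sub_conj_mul_ne_zero {w z : ℂ} (hw : ‖w‖ < 1) (hz : ‖z‖ < 1) :
    1 - conj w * z ≠ 0 := by
  intro h
  have : ‖conj w * z‖ = 1 := by rw [← sub_eq_zero.1 h, norm_one]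
  rw [norm_mul, RCLike.norm_conj] at this
  nlinarith [norm_nonneg w, norm_nonneg z]

theorem norm_discShift_lt_one {w z : ℂ} (hw : ‖w‖ < 1) (hz : ‖z‖ < 1) :
    ‖discShift w z‖ < 1 := by
  have hne := one_sub_conj_mul_ne_zero hw hz
  rw [discShift, norm_div, div_lt_one (norm_pos_iff.2 hne)]
  refine lt_of_pow_lt_pow_left₀ 2 (norm_nonneg _) ?_
  have key : ‖1 - conj w * z‖ ^ 2 - ‖z - w‖ ^ 2 = (1 - ‖w‖ ^ 2) * (1 - ‖z‖ ^ 2) := by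
    simp only [← normSq_eq_norm_sq, normSq_apply, sub_re, sub_im, mul_re, mul_im, conj_re,
      conj_im, one_re, one_im]
    ring
  have h1 : 0 < (1 - ‖w‖ ^ 2) * (1 - ‖z‖ ^ 2) := by
    apply mul_pos <;> nlinarith [norm_nonneg w, norm_nonneg z]
  linarith

theorem discShift_injOn {w : ℂ} (hw : ‖w‖ < 1) : InjOn (discShift w) (ball 0 1) := by
  intro x hx y hy h
  rw [mem_ball_zero_iff] at hx hy
  rw [discShift, discShift, div_eq_div_iff (one_sub_conj_mul_ne_zero hw hx)
    (one_sub_conj_mul_ne_zero hw hy)] at h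
  have : (1 - conj w * w) * (x - y) = 0 := by linear_combination h
  exact sub_eq_zero.1 ((mul_eq_zero.1 this).resolve_left (one_sub_conj_mul_ne_zero hw hw))

theorem discShift_eq_zero_iff {w z : ℂ} (hw : ‖w‖ < 1) (hz : ‖z‖ < 1) :
    discShift w z = 0 ↔ z = w := by
  rw [discShift, div_eq_zero_iff, or_iff_left (one_sub_conj_mul_ne_zero hw hz), sub_eq_zero]

theorem hasDerivAt_discShift {w z : ℂ} (hw : ‖w‖ < 1) (hz : ‖z‖ < 1) :
    HasDerivAt (discShift w) ((1 - ‖w‖ ^ 2) / (1 - conj w * z) ^ 2) z := by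
  have hne := one_sub_conj_mul_ne_zero hw hz
  have h := ((hasDerivAt_id z).sub_const w).div
    (((hasDerivAt_id z).const_mul (conj w)).const_sub 1) hne
  refine h.congr_deriv ?_
  rw [← conj_mul' w]
  simp only [id]
  ring

theorem HasDerivAt.of_sq_eq {h p : ℂ → ℂ} {p' c : ℂ} (hp : HasDerivAt p p' c)
    (hcont : ContinuousAt h c) (hsq : ∀ᶠ z in 𝓝 c, h z ^ 2 = p z) (hne : h c ≠ 0) :
    HasDerivAt h (p' / (2 * h c)) c := by
  rw [hasDerivAt_iff_tendsto_slope] at hp ⊢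
  have hsum : Tendsto (fun z => h z + h c) (𝓝[≠] c) (𝓝 (2 * h c)) := by
    rw [two_mul]
    exact (hcont.tendsto.mono_left nhdsWithin_le_nhds).add_const _
  have h2 : 2 * h c ≠ 0 := mul_ne_zero two_ne_zero hne
  refine (hp.div hsum h2).congr' ?_
  filter_upwards [hsum.eventually_ne h2, nhdsWithin_le_nhds hsq] with z hz hzsq
  rw [Pi.div_apply, div_eq_iff hz, slope_def_field, slope_def_field, ← hzsq, ← hsq.self_of_nhds]
  ring

/-- `f` is a holomorphic embedding of `D` into the open unit disc that fixes `0`. -/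
structure IsDiscEmbedding (D : Set ℂ) (f : ℂ → ℂ) : Prop where
  differentiableOn : DifferentiableOn ℂ f D
  mapsTo : MapsTo f D (ball 0 1)
  injOn : InjOn f D
  map_zero : f 0 = 0

/-- Koebe's square root trick. -/
theorem IsDiscEmbedding.exists_norm_deriv_lt {D : Set ℂ} {f : ℂ → ℂ} (hf : IsDiscEmbedding D f)
    (hD : IsOpen D) (hsc : IsSimplyConnected D) (h0 : (0 : ℂ) ∈ D) (hderiv : deriv f 0 ≠ 0)
    {w : ℂ} (hw : ‖w‖ < 1) (hwf : w ∉ f '' D) :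
    ∃ g, IsDiscEmbedding D g ∧ ‖deriv f 0‖ < ‖deriv g 0‖ := by
  have hmaps : ∀ z ∈ D, ‖f z‖ < 1 := fun z hz => mem_ball_zero_iff.1 (hf.mapsTo hz)
  have hfd : ∀ z ∈ D, HasDerivAt f (deriv f z) z := fun z hz =>
    (hf.differentiableOn.differentiableAt (hD.mem_nhds hz)).hasDerivAt
  have hpd : ∀ z ∈ D, HasDerivAt (discShift w ∘ f)
      ((1 - ‖w‖ ^ 2) / (1 - conj w * f z) ^ 2 * deriv f z) z := fun z hz =>
    (hasDerivAt_discShift hw (hmaps z hz)).comp z (hfd z hz)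
  have hpne : ∀ z ∈ D, discShift w (f z) ≠ 0 := fun z hz h =>
    hwf ⟨z, hz, (discShift_eq_zero_iff hw (hmaps z hz)).1 h⟩
  obtain ⟨h, hcont, hsq⟩ := exists_continuousOn_pow_eq hsc hD
    (g := discShift w ∘ f) (fun z hz => (hpd z hz).continuousAt.continuousWithinAt)
    (by rintro ⟨z, hz, h⟩; exact hpne z hz h) two_ne_zero
  have hne : ∀ z ∈ D, h z ≠ 0 := fun z hz hz0 => hpne z hz (by
    simpa [hz0] using (hsq z).symm)
  have hlt : ∀ z ∈ D, ‖h z‖ < 1 := fun z hz => by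
    rw [← pow_lt_one_iff_of_nonneg (norm_nonneg _) two_ne_zero, ← norm_pow, hsq]
    exact norm_discShift_lt_one hw (hmaps z hz)
  have hhd : ∀ z ∈ D, HasDerivAt h _ z := fun z hz =>
    (hpd z hz).of_sq_eq (hcont.continuousAt (hD.mem_nhds hz)) (.of_forall hsq) (hne z hz)
  have hgd : ∀ z ∈ D, HasDerivAt (discShift (h 0) ∘ h) _ z := fun z hz =>
    (hasDerivAt_discShift (hlt 0 h0) (hlt z hz)).comp z (hhd z hz)
  refine ⟨discShift (h 0) ∘ h, ⟨fun z hz => (hgd z hz).differentiableAt.differentiableWithinAt,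
    fun z hz => mem_ball_zero_iff.2 (norm_discShift_lt_one (hlt 0 h0) (hlt z hz)), ?_,
    by simp [discShift]⟩, ?_⟩
  · intro x hx y hy hxy
    have hh : h x = h y := discShift_injOn (hlt 0 h0) (mem_ball_zero_iff.2 (hlt x hx))
      (mem_ball_zero_iff.2 (hlt y hy)) hxy
    refine hf.injOn hx hy (discShift_injOn hw (hf.mapsTo hx) (hf.mapsTo hy) ?_)
    have hx2 := hsq x
    rw [hh, hsq y] at hx2
    exact hx2.symm
  · rw [(hgd 0 h0).deriv]
    have hs0 : 0 < ‖h 0‖ := norm_pos_iff.2 (hne 0 h0)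
    have hs1 := hlt 0 h0
    have hws : ‖w‖ = ‖h 0‖ ^ 2 := by
      rw [← norm_pow, hsq]; simp [discShift, hf.map_zero]
    have hconj : conj (h 0) * h 0 = ((‖h 0‖ ^ 2 : ℝ) : ℂ) := by
      rw [conj_mul', ofReal_pow]
    have e1 : ‖(1 : ℂ) - (‖w‖ : ℂ) ^ 2‖ = 1 - (‖h 0‖ ^ 2) ^ 2 := by
      rw [hws, ← ofReal_pow, ← ofReal_one, ← ofReal_sub, norm_real, Real.norm_of_nonneg]
      nlinarith [pow_lt_one₀ (pow_nonneg hs0.le 2) (pow_lt_one₀ hs0.le hs1 two_ne_zero) two_ne_zero]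
    have e2 : ‖(1 : ℂ) - (‖h 0‖ : ℂ) ^ 2‖ = 1 - ‖h 0‖ ^ 2 := by
      rw [← ofReal_pow, ← ofReal_one, ← ofReal_sub, norm_real, Real.norm_of_nonneg]
      nlinarith
    rw [hconj, hf.map_zero, ofReal_pow]
    simp only [norm_mul, norm_div, norm_pow, e1, e2, mul_zero, sub_zero, one_pow,
      div_one, Complex.norm_two]
    have hd : 0 < ‖deriv f 0‖ := norm_pos_iff.2 hderiv
    generalize ‖h 0‖ = s at *
    have hs2 : 0 < 1 - s ^ 2 := by nlinarith
    have : (1 - s ^ 2) / (1 - s ^ 2) ^ 2 * ((1 - (s ^ 2) ^ 2) * ‖deriv f 0‖ / (2 * s))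
        = (1 + s ^ 2) / (2 * s) * ‖deriv f 0‖ := by
      field_simp
      ring
    rw [this]
    refine lt_mul_of_one_lt_left hd ((one_lt_div (by positivity)).2 ?_)
    nlinarith [sq_pos_of_pos (sub_pos.2 hs1)]

theorem isOpen_image_of_injOn {D : Set ℂ} {f : ℂ → ℂ} (hD : IsOpen D) (hconn : IsPreconnected D)
    (hf : DifferentiableOn ℂ f D) (hinj : InjOn f D) {s : Set ℂ} (hsD : s ⊆ D) (hs : IsOpen s) :
    IsOpen (f '' s) := by
  refine ((hf.analyticOnNhd hD).is_constant_or_isOpen hconn).elim (fun ⟨w, hw⟩ => ?_)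
    fun h => h s hsD hs
  rcases s.eq_empty_or_nonempty with rfl | ⟨x, hx⟩
  · simp
  obtain ⟨y, hy, hyx⟩ := nonempty_of_mem (f := 𝓝[≠] x)
    (inter_mem (mem_nhdsWithin_of_mem_nhds (hD.mem_nhds (hsD hx))) self_mem_nhdsWithin)
  exact absurd (hinj hy (hsD hx) ((hw y hy).trans (hw x (hsD hx)).symm)) hyx

/-- The Riemann mapping theorem for bounded domains. -/
theorem exists_isDiscEmbedding_image_eq_ball {D : Set ℂ} (hD : IsOpen D)
    (hsc : IsSimplyConnected D) (hbdd : Bornology.IsBounded D) (h0 : (0 : ℂ) ∈ D) :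
    ∃ f, IsDiscEmbedding D f ∧ f '' D = ball 0 1 := by
  obtain ⟨R, hR, hDR⟩ := hbdd.subset_ball_lt 0 0
  obtain ⟨r, hr, hrD⟩ := isOpen_iff.1 hD 0 h0
  have hconn : IsPreconnected D := hsc.isPathConnected.isConnected.isPreconnected
  have hRC : (R : ℂ) ≠ 0 := ofReal_ne_zero.2 hR.ne'
  have hscale : IsDiscEmbedding D fun z => z / R := by
    refine ⟨by fun_prop, fun z hz => ?_, fun x _ y _ h => (div_left_inj' hRC).1 h, by simp⟩
    have := mem_ball_zero_iff.1 (hDR hz)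
    rw [mem_ball_zero_iff, norm_div, norm_real, Real.norm_of_nonneg hR.le]
    exact (div_lt_one hR).2 this
  set S : Set ℝ := {x | ∃ f, IsDiscEmbedding D f ∧ ‖deriv f 0‖ = x}
  have hSne : S.Nonempty := ⟨_, _, hscale, rfl⟩
  have hSbdd : BddAbove S := by
    refine ⟨1 / r, ?_⟩
    rintro _ ⟨f, hf, rfl⟩
    refine norm_deriv_le_div_of_mapsTo_ball (hf.differentiableOn.mono hrD) (fun z hz => ?_) hr
    rw [hf.map_zero]
    exact ball_subset_closedBall (hf.mapsTo (hrD hz))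
  obtain ⟨u, -, hu, huS⟩ := exists_seq_tendsto_sSup hSne hSbdd
  choose F hF hFu using huS
  obtain ⟨g, hg⟩ := exists_tendstoLocallyUniformlyOn_of_mapsTo_closedBall hD (hyperfilter ℕ)
    (fun i => (hF i).differentiableOn) (fun i => (hF i).mapsTo.mono_right ball_subset_closedBall)
  have hle : (hyperfilter ℕ : Filter ℕ) ≤ atTop := Nat.hyperfilter_le_atTop
  have hFd : ∀ᶠ i in (hyperfilter ℕ : Filter ℕ), DifferentiableOn ℂ (F i) D :=
    .of_forall fun i => (hF i).differentiableOn
  have hgdiff := hg.differentiableOn hFd hD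
  have hgS : ‖deriv g 0‖ = sSup S := by
    refine tendsto_nhds_unique ((hg.deriv hFd hD).tendsto_at h0).norm ?_
    simpa only [Function.comp_apply, hFu] using hu.mono_left hle
  have hgne : deriv g 0 ≠ 0 := by
    rw [← norm_pos_iff, hgS]
    refine lt_of_lt_of_le ?_ (le_csSup hSbdd ⟨_, hscale, rfl⟩)
    simp [hR.ne']
  have hginj := injOn_of_tendstoLocallyUniformlyOn hD hconn (fun i => (hF i).differentiableOn)
    (fun i => (hF i).injOn) hg h0 hgne
  have hgle : MapsTo g D (closedBall 0 1) := fun z hz =>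
    isClosed_closedBall.mem_of_tendsto (hg.tendsto_at hz)
      (.of_forall fun i => ball_subset_closedBall ((hF i).mapsTo hz))
  have hgmaps : MapsTo g D (ball 0 1) := by
    have hopen := isOpen_image_of_injOn hD hconn hgdiff hginj subset_rfl hD
    rw [mapsTo_iff_image_subset, ← interior_closedBall _ one_ne_zero]
    exact interior_maximal hgle.image_subset hopen
  have hgemb : IsDiscEmbedding D g := ⟨hgdiff, hgmaps, hginj,
    tendsto_nhds_unique (hg.tendsto_at h0) (by simp [(hF _).map_zero])⟩
  refine ⟨g, hgemb, hgmaps.image_subset.antisymm fun w hw => ?_⟩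
  by_contra hwg
  obtain ⟨f, hf, hlt⟩ := hgemb.exists_norm_deriv_lt hD hsc h0 hgne (mem_ball_zero_iff.1 hw) hwg
  exact (hgS ▸ hlt).not_ge (le_csSup hSbdd ⟨f, hf, rfl⟩)

/-- The inverse of an injective holomorphic function is holomorphic. -/
theorem differentiableOn_invFunOn_image {D : Set ℂ} {f : ℂ → ℂ} (hD : IsOpen D)
    (hconn : IsPreconnected D) (hf : DifferentiableOn ℂ f D) (hinj : InjOn f D) :
    DifferentiableOn ℂ (Function.invFunOn f D) (f '' D) := by
  have hopen : ∀ {s}, s ⊆ D → IsOpen s → IsOpen (f '' s) := fun hsD hs =>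
    isOpen_image_of_injOn hD hconn hf hinj hsD hs
  set G := Function.invFunOn f D
  have hleft : ∀ z ∈ D, G (f z) = z := fun z hz => hinj.leftInvOn_invFunOn hz
  have hcont : ∀ z ∈ D, ContinuousAt G (f z) := by
    intro z hz
    rw [ContinuousAt, hleft z hz, tendsto_def]
    intro s hs
    obtain ⟨t, hts, ht, hzt⟩ := _root_.mem_nhds_iff.1 (inter_mem hs (hD.mem_nhds hz))
    refine mem_of_superset ((hopen (fun x hx => (hts hx).2) ht).mem_nhds ⟨z, hzt, rfl⟩) ?_
    rintro _ ⟨x, hx, rfl⟩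
    rw [mem_preimage, hleft x (hts hx).2]
    exact (hts hx).1
  have hdiff : ∀ z ∈ D, deriv f z ≠ 0 → DifferentiableAt ℂ G (f z) := by
    intro z hz hne
    refine (HasDerivAt.of_local_left_inverse (hcont z hz) (f := f) (f' := deriv f z) ?_ hne
      ?_).differentiableAt
    · rw [hleft z hz]
      exact (hf.differentiableAt (hD.mem_nhds hz)).hasDerivAt
    · filter_upwards [(hopen subset_rfl hD).mem_nhds ⟨z, hz, rfl⟩] with y hy
        using Function.invFunOn_eq hy
  rintro _ ⟨z, hz, rfl⟩
  have hisol : ∀ᶠ x in 𝓝[≠] z, deriv f x ≠ 0 := by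
    refine ((hf.analyticOnNhd hD).deriv z hz).eventually_eq_zero_or_eventually_ne_zero.resolve_left
      fun h => ?_
    obtain ⟨r, hr, hball⟩ := isOpen_iff.1 (hD.inter isOpen_interior) z
      ⟨hz, mem_interior_iff_mem_nhds.2 h⟩
    obtain ⟨x, hx, hxz⟩ : ∃ x ∈ ball z r, x ≠ z := by
      refine ⟨z + (r / 2 : ℝ), ?_, ?_⟩
      · simp [abs_of_pos hr, hr]
      · simp [hr.ne']
    refine hxz (hinj (hball hx).1 hz ?_)
    refine isOpen_ball.is_const_of_deriv_eq_zero (convex_ball z r).isPreconnected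
      (hf.mono fun y hy => (hball hy).1) (fun y hy => ?_) hx (mem_ball_self hr)
    exact interior_subset (s := {y | deriv f y = 0}) (hball hy).2
  obtain ⟨t, ht, htopen, hzt⟩ := _root_.eventually_nhds_iff.1
    ((eventually_nhdsWithin_iff.1 hisol).and (hD.mem_nhds hz))
  have himg : f '' t ∈ 𝓝 (f z) := (hopen (fun x hx => (ht x hx).2) htopen).mem_nhds ⟨z, hzt, rfl⟩
  refine (((differentiableOn_compl_singleton_and_continuousAt_iff himg).1
    ⟨?_, hcont z hz⟩).differentiableAt himg).differentiableWithinAt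
  rintro _ ⟨⟨x, hx, rfl⟩, hxz⟩
  exact (hdiff x (ht x hx).2 ((ht x hx).1 fun h => hxz (congrArg f h))).differentiableWithinAt

/-- A nonempty bounded open simply connected plane domain containing
`0` is holomorphically contractible to `0`. -/
theorem holomorphically_contractible_of_simply_connected
    (D : Set ℂ) (hD : IsOpen D) (hne : D.Nonempty)
    (hbdd : Bornology.IsBounded D) [SimplyConnectedSpace D] (h0 : (0 : ℂ) ∈ D) :
    ∃ F : ℂ → ℝ → ℂ,
      ContinuousOn (fun p : ℂ × ℝ => F p.1 p.2) (D ×ˢ Set.Icc (0 : ℝ) 1) ∧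
      (∀ t ∈ Set.Icc (0 : ℝ) 1,
        DifferentiableOn ℂ (fun z => F z t) D ∧ Set.MapsTo (fun z => F z t) D D) ∧
      (∀ z ∈ D, F z 0 = z) ∧ (∀ z ∈ D, F z 1 = 0) ∧
      (∀ t ∈ Set.Icc (0 : ℝ) 1, F 0 t = 0) := by
  have hsc : IsSimplyConnected D := ‹SimplyConnectedSpace D›
  obtain ⟨f, hf, himg⟩ := exists_isDiscEmbedding_image_eq_ball hD hsc hbdd h0
  have hG := differentiableOn_invFunOn_image hD hsc.isPathConnected.isConnected.isPreconnected
    hf.differentiableOn hf.injOn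
  have hmemG : ∀ w ∈ f '' D, Function.invFunOn f D w ∈ D := fun w hw => Function.invFunOn_mem hw
  have hleft : ∀ z ∈ D, Function.invFunOn f D (f z) = z := fun z hz =>
    hf.injOn.leftInvOn_invFunOn hz
  have hG0 : Function.invFunOn f D 0 = 0 := by simpa only [hf.map_zero] using hleft 0 h0
  have hmaps : ∀ t ∈ Icc (0 : ℝ) 1, ∀ z ∈ D, ((1 - t : ℝ) : ℂ) * f z ∈ f '' D := by
    intro t ht z hz
    have := mem_ball_zero_iff.1 (hf.mapsTo hz)
    rw [himg, mem_ball_zero_iff, norm_mul, norm_real, Real.norm_of_nonneg (by linarith [ht.2])]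
    nlinarith [norm_nonneg (f z), ht.1, ht.2]
  refine ⟨fun z t => Function.invFunOn f D (((1 - t : ℝ) : ℂ) * f z), ?_, fun t ht => ⟨?_, ?_⟩,
    fun z hz => ?_, fun z _ => ?_, fun t _ => ?_⟩
  · refine hG.continuousOn.comp (ContinuousOn.mul (by fun_prop)
      (hf.differentiableOn.continuousOn.comp continuousOn_fst fun p hp => hp.1))
      fun p hp => hmaps p.2 hp.2 p.1 hp.1
  · exact hG.comp (hf.differentiableOn.const_mul _) fun z hz => hmaps t ht z hz
  · exact fun z hz => hmemG _ (hmaps t ht z hz)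
  · simpa using hleft z hz
  · simpa using hG0
  · simpa [hf.map_zero] using hG0
end
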